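/- Let Y and Z be jointly distributed finite-valued random variables. Then there exists a random variable X adjoinable to (Y,Z) satisfying I(Y;Z|X) = 0, H(X|Y) = 0 and H(X|Z) = 0, if and only if there exists a random variable U adjoinable to (Y,Z) satisfying I(Y;Z|U) = 0, I(Z;U|Y) = 0 and I(U;Y|Z) = 0. -/

import Mathlib

namespace CIPaper

/-- A bundled probability space. -/
structure ProbSpace where
  carrier : Type
  [inst : MeasurableSpace carrier]
  μ : MeasureTheory.Measure carrier
  [isProb : MeasureTheory.IsProbabilityMeasure μ]

attribute [instance] ProbSpace.inst ProbSpace.isProb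

/-- A bundled finite measurable alphabet, used as value space of auxiliary random variables. -/
structure FinAlphabet where
  carrier : Type
  [fin : Fintype carrier]
  [ms : MeasurableSpace carrier]
  [msc : MeasurableSingletonClass carrier]

attribute [instance] FinAlphabet.fin FinAlphabet.ms FinAlphabet.msc

open MeasureTheory ProbabilityTheory Real

variable {Ω : Type*} [MeasurableSpace Ω] {S T U : Type*}

/-- P(X = x). -/
noncomputable def pr (μ : Measure Ω) (X : Ω → S) (x : S) : ℝ :=
  (μ (X ⁻¹' {x})).toReal

/-- Shannon entropy (base 2) of a finite-valued random variable. -/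
noncomputable def ent (μ : Measure Ω) [Fintype S] (X : Ω → S) : ℝ :=
  (∑ x, Real.negMulLog (pr μ X x)) / Real.log 2

/-- Conditional entropy H(X|Y). -/
noncomputable def condEnt (μ : Measure Ω) [Fintype S] [Fintype T]
    (X : Ω → S) (Y : Ω → T) : ℝ :=
  ent μ (fun ω => (X ω, Y ω)) - ent μ Y

/-- Mutual information I(X;Y). -/
noncomputable def mi (μ : Measure Ω) [Fintype S] [Fintype T]
    (X : Ω → S) (Y : Ω → T) : ℝ :=
  ent μ X + ent μ Y - ent μ (fun ω => (X ω, Y ω))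

/-- Conditional mutual information I(X;Y|Z). -/
noncomputable def cmi (μ : Measure Ω) [Fintype S] [Fintype T] [Fintype U]
    (X : Ω → S) (Y : Ω → T) (Z : Ω → U) : ℝ :=
  ent μ (fun ω => (X ω, Z ω)) + ent μ (fun ω => (Y ω, Z ω))
    - ent μ (fun ω => (X ω, (Y ω, Z ω))) - ent μ Z

/-- The support of a random variable: values of positive probability. -/
def support (μ : Measure Ω) (X : Ω → S) : Set S := {x | 0 < pr μ X x}

/-- X is uniformly distributed over its support. -/
def IsUniform (μ : Measure Ω) (X : Ω → S) : Prop :=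
  ∀ x ∈ support μ X, ∀ y ∈ support μ X, pr μ X x = pr μ X y

/-- X is uniformly distributed over a support of size n. -/
def UniformOn (μ : Measure Ω) (X : Ω → S) (n : ℕ) : Prop :=
  IsUniform μ X ∧ (support μ X).ncard = n

/-- The TRIPLE predicate: pairwise independence plus each variable a function of the
other two. -/
def TRIPLE (μ : Measure Ω) [Fintype S] [Fintype T] [Fintype U]
    (X : Ω → S) (Y : Ω → T) (Z : Ω → U) : Prop :=
  condEnt μ X (fun ω => (Y ω, Z ω)) = 0 ∧ condEnt μ Y (fun ω => (X ω, Z ω)) = 0 ∧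
    condEnt μ Z (fun ω => (X ω, Y ω)) = 0 ∧
    mi μ X Y = 0 ∧ mi μ X Z = 0 ∧ mi μ Y Z = 0

end CIPaper

namespace CIPaper

open MeasureTheory ProbabilityTheory Real

section FiniteSums

/-- The summand of the relative entropy is nonnegative, and vanishes only on the diagonal. -/
theorem relEnt_term {p a b c : ℝ} (hp : 0 ≤ p) (ha : p ≤ a) (hb : p ≤ b) (hac : a ≤ c) :
    0 ≤ p * (log p + log c - log a - log b) - p + a * b / c ∧
      (p * (log p + log c - log a - log b) - p + a * b / c = 0 ↔ p * c = a * b) := by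
  rcases hp.eq_or_lt with rfl | hp
  · have hc : 0 ≤ c := ha.trans hac
    refine ⟨by simp only [zero_mul, sub_zero, zero_add]; positivity, ?_⟩
    rcases hc.eq_or_lt with rfl | hc
    · have : a = 0 := le_antisymm hac ha
      simp [this]
    · simp [hc.ne', eq_comm]
  · have ha' : 0 < a := hp.trans_le ha
    have hb' : 0 < b := hp.trans_le hb
    have hc' : 0 < c := ha'.trans_le hac
    have hs : 0 < a * b / (p * c) := by positivity
    have hlog : log (a * b / (p * c)) = log a + log b - log p - log c := by
      rw [log_div (by positivity) (by positivity), log_mul ha'.ne' hb'.ne',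
        log_mul hp.ne' hc'.ne']
      ring
    have hterm : p * (log p + log c - log a - log b) - p + a * b / c =
        p * (a * b / (p * c) - 1 - log (a * b / (p * c))) := by
      rw [hlog]
      field_simp
      ring
    have hle := log_le_sub_one_of_pos hs
    rw [hterm]
    refine ⟨mul_nonneg hp.le (by linarith), ?_, ?_⟩
    · intro h
      by_contra hne
      have hne' : a * b / (p * c) ≠ 1 := by
        intro h1
        rw [div_eq_one_iff_eq (by positivity)] at h1
        exact hne h1.symm
      have := log_lt_sub_one_of_pos hs hne'
      rcases mul_eq_zero.1 h with h | h <;> linarith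
    · intro h
      rw [← h, div_self (by positivity)]
      simp

variable {S T U : Type*} [Fintype S] [Fintype T] [Fintype U]

/-- Conditional mutual information of a finite nonnegative array vanishes iff the array
factorizes. -/
theorem sum_negMulLog_eq_zero_iff {p : S → T → U → ℝ} {a : S → U → ℝ} {b : T → U → ℝ}
    {c : U → ℝ} (hp : ∀ x y z, 0 ≤ p x y z) (ha : ∀ x z, a x z = ∑ y, p x y z)
    (hb : ∀ y z, b y z = ∑ x, p x y z) (hca : ∀ z, c z = ∑ x, a x z)
    (hcb : ∀ z, c z = ∑ y, b y z) :
    (∑ x, ∑ z, negMulLog (a x z)) + (∑ y, ∑ z, negMulLog (b y z))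
        - (∑ x, ∑ y, ∑ z, negMulLog (p x y z)) - ∑ z, negMulLog (c z) = 0 ↔
      ∀ x y z, p x y z * c z = a x z * b y z := by
  have hterm := fun x y z => relEnt_term (a := a x z) (b := b y z) (c := c z) (hp x y z)
    (by rw [ha]; exact Finset.single_le_sum (f := fun y => p x y z) (fun i _ => hp x i z)
          (Finset.mem_univ y))
    (by rw [hb]; exact Finset.single_le_sum (f := fun x => p x y z) (fun i _ => hp i y z)
          (Finset.mem_univ x))
    (by rw [hca]; exact Finset.single_le_sum (f := fun x => a x z)
          (fun i _ => by rw [ha]; exact Finset.sum_nonneg fun y _ => hp i y z)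
          (Finset.mem_univ x))
  have hA : ∑ x, ∑ z, negMulLog (a x z) = -∑ x, ∑ y, ∑ z, p x y z * log (a x z) := by
    rw [← Finset.sum_neg_distrib]
    refine Finset.sum_congr rfl fun x _ => ?_
    rw [Finset.sum_comm, ← Finset.sum_neg_distrib]
    refine Finset.sum_congr rfl fun z _ => ?_
    rw [← Finset.sum_mul, ← ha, negMulLog, neg_mul]
  have hB : ∑ y, ∑ z, negMulLog (b y z) = -∑ x, ∑ y, ∑ z, p x y z * log (b y z) := by
    rw [Finset.sum_comm (s := (Finset.univ : Finset S)), ← Finset.sum_neg_distrib]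
    refine Finset.sum_congr rfl fun y _ => ?_
    rw [Finset.sum_comm, ← Finset.sum_neg_distrib]
    refine Finset.sum_congr rfl fun z _ => ?_
    rw [← Finset.sum_mul, ← hb, negMulLog, neg_mul]
  have hC : ∑ z, negMulLog (c z) = -∑ x, ∑ y, ∑ z, p x y z * log (c z) := by
    have : ∑ x, ∑ y, ∑ z, p x y z * log (c z) = ∑ x, ∑ z, a x z * log (c z) :=
      Finset.sum_congr rfl fun x _ => by
        rw [Finset.sum_comm]
        exact Finset.sum_congr rfl fun z _ => by rw [← Finset.sum_mul, ← ha]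
    rw [this, Finset.sum_comm, ← Finset.sum_neg_distrib]
    refine Finset.sum_congr rfl fun z _ => ?_
    rw [← Finset.sum_mul, ← hca, negMulLog, neg_mul]
  have hP : ∑ x, ∑ y, ∑ z, negMulLog (p x y z) =
      -∑ x, ∑ y, ∑ z, p x y z * log (p x y z) := by
    simp only [negMulLog, neg_mul, Finset.sum_neg_distrib]
  have hmass : ∑ x, ∑ y, ∑ z, p x y z = ∑ x, ∑ y, ∑ z, a x z * b y z / c z := by
    have h1 : ∑ x, ∑ y, ∑ z, p x y z = ∑ z, c z := by
      simp only [hca, ha]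
      rw [Finset.sum_comm (s := (Finset.univ : Finset U))]
      exact Finset.sum_congr rfl fun x _ => Finset.sum_comm
    have h2 : ∑ x, ∑ y, ∑ z, a x z * b y z / c z = ∑ x, ∑ z, a x z * c z / c z :=
      Finset.sum_congr rfl fun x _ => by
        rw [Finset.sum_comm]
        exact Finset.sum_congr rfl fun z _ => by
          rw [← Finset.sum_div, ← Finset.mul_sum, ← hcb]
    rw [h1, h2, Finset.sum_comm]
    exact Finset.sum_congr rfl fun z _ => by
      rw [← Finset.sum_div, ← Finset.sum_mul, ← hca, mul_self_div_self]
  have hsum : (∑ x, ∑ z, negMulLog (a x z)) + (∑ y, ∑ z, negMulLog (b y z))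
        - (∑ x, ∑ y, ∑ z, negMulLog (p x y z)) - ∑ z, negMulLog (c z) =
      ∑ x, ∑ y, ∑ z, (p x y z * (log (p x y z) + log (c z) - log (a x z) - log (b y z))
        - p x y z + a x z * b y z / c z) := by
    simp only [mul_sub, mul_add, Finset.sum_sub_distrib, Finset.sum_add_distrib]
    rw [hA, hB, hC, hP, hmass]
    ring
  rw [hsum, Finset.sum_eq_zero_iff_of_nonneg fun x _ => Finset.sum_nonneg fun y _ =>
    Finset.sum_nonneg fun z _ => (hterm x y z).1]
  simp only [Finset.mem_univ, true_imp_iff]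
  refine forall_congr' fun x => ?_
  rw [Finset.sum_eq_zero_iff_of_nonneg fun y _ => Finset.sum_nonneg fun z _ => (hterm x y z).1]
  simp only [Finset.mem_univ, true_imp_iff]
  refine forall_congr' fun y => ?_
  rw [Finset.sum_eq_zero_iff_of_nonneg fun z _ => (hterm x y z).1]
  simp only [Finset.mem_univ, true_imp_iff]
  exact forall_congr' fun z => (hterm x y z).2

end FiniteSums

section Pr

variable {Ω S T U : Type*} [MeasurableSpace Ω] {μ : Measure Ω}

theorem pr_nonneg (X : Ω → S) (x : S) : 0 ≤ pr μ X x := ENNReal.toReal_nonneg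

theorem pr_congr {X : Ω → S} {Y : Ω → T} {x : S} {y : T} (h : ∀ ω, X ω = x ↔ Y ω = y) :
    pr μ X x = pr μ Y y := by
  unfold pr
  congr 2
  ext ω
  exact h ω

theorem pr_eq_zero_of_forall_ne {X : Ω → S} {x : S} (h : ∀ ω, X ω ≠ x) : pr μ X x = 0 := by
  have : X ⁻¹' {x} = ∅ := Set.eq_empty_of_forall_notMem h
  rw [pr, this, measure_empty, ENNReal.toReal_zero]

theorem pr_swap (X : Ω → S) (Y : Ω → T) (x : S) (y : T) :
    pr μ (fun ω => (Y ω, X ω)) (y, x) = pr μ (fun ω => (X ω, Y ω)) (x, y) :=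
  pr_congr fun ω => by simp [and_comm]

theorem pr_left_comm (X : Ω → S) (Y : Ω → T) (Z : Ω → U) (x : S) (y : T) (z : U) :
    pr μ (fun ω => (Y ω, (X ω, Z ω))) (y, (x, z)) =
      pr μ (fun ω => (X ω, (Y ω, Z ω))) (x, (y, z)) :=
  pr_congr fun ω => by simp [and_left_comm]

theorem pr_rotate (X : Ω → S) (Y : Ω → T) (Z : Ω → U) (x : S) (y : T) (z : U) :
    pr μ (fun ω => (Y ω, (Z ω, X ω))) (y, (z, x)) =
      pr μ (fun ω => (X ω, (Y ω, Z ω))) (x, (y, z)) :=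
  pr_congr fun ω => by simp only [Prod.mk.injEq]; tauto

theorem pr_diag [DecidableEq S] (X : Ω → S) (Y : Ω → T) (x x' : S) (y : T) :
    pr μ (fun ω => (X ω, (X ω, Y ω))) (x, (x', y)) =
      if x = x' then pr μ (fun ω => (X ω, Y ω)) (x, y) else 0 := by
  split_ifs with h
  · exact pr_congr fun ω => by simp [h]
  · exact pr_eq_zero_of_forall_ne fun ω => by grind

theorem pr_pair_comp [DecidableEq T] (f : S → T) (X : Ω → S) (x : S) (t : T) :
    pr μ (fun ω => (X ω, f (X ω))) (x, t) = if f x = t then pr μ X x else 0 := by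
  split_ifs with h
  · exact pr_congr fun ω => by grind
  · exact pr_eq_zero_of_forall_ne fun ω => by grind

theorem pr_pair_comp_pair [DecidableEq T] (f : S → T) (X : Ω → S) (Y : Ω → U) (x : S) (t : T)
    (y : U) :
    pr μ (fun ω => (X ω, (f (X ω), Y ω))) (x, (t, y)) =
      if f x = t then pr μ (fun ω => (X ω, Y ω)) (x, y) else 0 := by
  split_ifs with h
  · exact pr_congr fun ω => by grind
  · exact pr_eq_zero_of_forall_ne fun ω => by grind

theorem condEnt_eq_cmi [Fintype S] [Fintype U] (X : Ω → S) (Y : Ω → U) :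
    condEnt μ X Y = cmi μ X X Y := by
  have h : ent μ (fun ω => (X ω, (X ω, Y ω))) = ent μ (fun ω => (X ω, Y ω)) := by
    classical
    unfold ent
    congr 1
    simp only [Fintype.sum_prod_type, pr_diag]
    refine Finset.sum_congr rfl fun x _ => ?_
    rw [Finset.sum_comm]
    refine Finset.sum_congr rfl fun y _ => ?_
    rw [Finset.sum_eq_single x]
    · simp
    · intro x' _ hx
      simp [hx.symm]
    · simp
  rw [condEnt, cmi, h]
  ring

variable [IsFiniteMeasure μ]

theorem pr_eq_sum [Fintype T] [MeasurableSpace T] [MeasurableSingletonClass T]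
    (X : Ω → S) {Y : Ω → T} (hY : Measurable Y) (x : S) :
    pr μ X x = ∑ y, pr μ (fun ω => (Y ω, X ω)) (y, x) := by
  unfold pr
  rw [← ENNReal.toReal_sum fun _ _ => measure_ne_top _ _]
  congr 1
  have h := sum_measure_preimage_singleton (μ := μ.restrict (X ⁻¹' {x})) Finset.univ
    fun y _ => hY (measurableSet_singleton y)
  rw [Finset.coe_univ, Set.preimage_univ, Measure.restrict_apply_univ] at h
  rw [← h]
  refine Finset.sum_congr rfl fun y _ => ?_
  rw [Measure.restrict_apply (hY (measurableSet_singleton y))]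
  congr 1
  ext ω
  simp

theorem pr_pair_le (X : Ω → S) (Y : Ω → T) (x : S) (y : T) :
    pr μ (fun ω => (X ω, Y ω)) (x, y) ≤ pr μ Y y := by
  refine ENNReal.toReal_mono (measure_ne_top _ _) (measure_mono fun ω hω => ?_)
  simp only [Set.mem_preimage, Set.mem_singleton_iff, Prod.mk.injEq] at hω ⊢
  exact hω.2

theorem pr_pair_eq_zero {Y : Ω → T} {y : T} (h : pr μ Y y = 0) (X : Ω → S) (x : S) :
    pr μ (fun ω => (X ω, Y ω)) (x, y) = 0 :=
  le_antisymm (h ▸ pr_pair_le X Y x y) (pr_nonneg _ _)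

theorem pr_pair_eq_zero_right {X : Ω → S} {x : S} (h : pr μ X x = 0) (Y : Ω → T) (y : T) :
    pr μ (fun ω => (X ω, Y ω)) (x, y) = 0 := by
  rw [pr_swap Y X]
  exact pr_pair_eq_zero h Y y

variable [Fintype S] [MeasurableSpace S] [MeasurableSingletonClass S]
  [Fintype T] [MeasurableSpace T] [MeasurableSingletonClass T] [Fintype U]

/-- Vanishing conditional mutual information is conditional independence. -/
theorem cmi_eq_zero_iff {X : Ω → S} {Y : Ω → T} (Z : Ω → U) (hX : Measurable X)
    (hY : Measurable Y) :
    cmi μ X Y Z = 0 ↔ ∀ x y z, pr μ (fun ω => (X ω, (Y ω, Z ω))) (x, (y, z)) * pr μ Z z =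
      pr μ (fun ω => (X ω, Z ω)) (x, z) * pr μ (fun ω => (Y ω, Z ω)) (y, z) := by
  rw [← sum_negMulLog_eq_zero_iff
    (p := fun x y z => pr μ (fun ω => (X ω, (Y ω, Z ω))) (x, (y, z)))
    (a := fun x z => pr μ (fun ω => (X ω, Z ω)) (x, z))
    (b := fun y z => pr μ (fun ω => (Y ω, Z ω)) (y, z)) (c := fun z => pr μ Z z)
    (fun x y z => pr_nonneg _ _)
    (fun x z => by
      rw [pr_eq_sum _ hY]
      exact Finset.sum_congr rfl fun y _ => pr_left_comm X Y Z x y z)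
    (fun y z => pr_eq_sum _ hX _) (fun z => pr_eq_sum _ hX _) (fun z => pr_eq_sum _ hY _)]
  have hlog : log 2 ≠ 0 := (log_pos one_lt_two).ne'
  unfold cmi ent
  simp only [Fintype.sum_prod_type]
  rw [← add_div, ← sub_div, ← sub_div, div_eq_zero_iff, or_iff_left hlog]

theorem cmi_swap_eq_zero {X : Ω → S} {Y : Ω → T} {Z : Ω → U} (hX : Measurable X)
    (hY : Measurable Y) (h : cmi μ X Y Z = 0) : cmi μ Y X Z = 0 := by
  rw [cmi_eq_zero_iff Z hX hY] at h
  rw [cmi_eq_zero_iff Z hY hX]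
  intro y x z
  rw [pr_left_comm X Y Z, h, mul_comm]

/-- Vanishing conditional entropy: each value of positive probability of the conditioning
variable is compatible with only one value of the other variable. -/
theorem condEnt_eq_zero_iff {X : Ω → S} (Y : Ω → U) (hX : Measurable X) :
    condEnt μ X Y = 0 ↔ ∀ x x' y, x ≠ x' → pr μ (fun ω => (X ω, Y ω)) (x, y) = 0 ∨
      pr μ (fun ω => (X ω, Y ω)) (x', y) = 0 := by
  classical
  rw [condEnt_eq_cmi, cmi_eq_zero_iff Y hX hX]
  simp only [pr_diag]
  constructor
  · intro h x x' y hne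
    have := h x x' y
    rw [if_neg hne, zero_mul] at this
    exact mul_eq_zero.1 this.symm
  · intro h x x' y
    split_ifs with hx
    · subst hx
      by_cases h0 : pr μ (fun ω => (X ω, Y ω)) (x, y) = 0
      · simp [h0]
      · rw [pr_eq_sum Y hX y, Finset.sum_eq_single x]
        · intro x' _ hne
          exact (h x x' y hne.symm).resolve_left h0
        · simp
    · rw [zero_mul, eq_comm, mul_eq_zero]
      exact h x x' y hx

theorem cmi_eq_zero_of_condEnt_eq_zero {X : Ω → S} {Z : Ω → T} {Y : Ω → U} (hX : Measurable X)
    (hZ : Measurable Z) (h : condEnt μ X Y = 0) : cmi μ X Z Y = 0 := by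
  rw [condEnt_eq_zero_iff Y hX] at h
  rw [cmi_eq_zero_iff Y hX hZ]
  intro x z y
  rw [← pr_left_comm X Z Y]
  by_cases h0 : pr μ (fun ω => (X ω, Y ω)) (x, y) = 0
  · rw [pr_pair_eq_zero h0, h0, zero_mul, zero_mul]
  · have h1 : ∀ x' ≠ x, pr μ (fun ω => (X ω, Y ω)) (x', y) = 0 := fun x' hne =>
      (h x x' y hne.symm).resolve_left h0
    rw [pr_eq_sum Y hX y, Finset.sum_eq_single x (fun x' _ hne => h1 x' hne) (by simp),
      pr_eq_sum (fun ω => (Z ω, Y ω)) hX (z, y),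
      Finset.sum_eq_single x (fun x' _ hne => ?_) (by simp), pr_left_comm X Z Y, mul_comm]
    rw [← pr_left_comm X Z Y]
    exact pr_pair_eq_zero (h1 x' hne) Z z

/-- The double Markov property: if `W - Y - Z` and `Y - Z - W` are Markov chains and `Y`, `Z` are
independent given `W`, then the conditional law of `W` given `Y` is a common part of `Y` and `Z`
given which they are independent. -/
theorem exists_common_part [MeasurableSpace U] [MeasurableSingletonClass U] {Y : Ω → S} {Z : Ω → T}
    {W : Ω → U} (hY : Measurable Y) (hZ : Measurable Z) (hW : Measurable W)
    (hYZ : cmi μ Y Z W = 0) (hZW : cmi μ Z W Y = 0) (hWY : cmi μ W Y Z = 0) :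
    ∃ (n : ℕ) (f : S → Fin n), cmi μ Y Z (fun ω => f (Y ω)) = 0 ∧
      condEnt μ (fun ω => f (Y ω)) Y = 0 ∧ condEnt μ (fun ω => f (Y ω)) Z = 0 := by
  rw [cmi_eq_zero_iff _ hY hZ] at hYZ
  rw [cmi_eq_zero_iff _ hZ hW] at hZW
  rw [cmi_eq_zero_iff _ hW hY] at hWY
  let k : S → U → ℝ := fun y u => pr μ (fun ω => (W ω, Y ω)) (u, y) / pr μ Y y
  obtain ⟨n, f, hf⟩ : ∃ (n : ℕ) (f : S → Fin n), ∀ y y', f y = f y' ↔ k y = k y' :=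
    ⟨_, fun y => Finite.equivFin (Set.range k) (Set.rangeFactorization k y), fun y y' => by
      rw [EmbeddingLike.apply_eq_iff_eq, Subtype.ext_iff]; rfl⟩
  have hk : ∀ y u, pr μ (fun ω => (Y ω, W ω)) (y, u) = k y u * pr μ Y y := by
    intro y u
    rw [← pr_swap]
    by_cases h0 : pr μ Y y = 0
    · rw [h0, mul_zero, pr_pair_eq_zero h0]
    · exact (div_mul_cancel₀ _ h0).symm
  have hcross : ∀ y y' z, k y' = k y →
      pr μ (fun ω => (Y ω, Z ω)) (y, z) * pr μ Y y' =
        pr μ Y y * pr μ (fun ω => (Y ω, Z ω)) (y', z) := by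
    have hsum : ∀ y z, pr μ (fun ω => (Y ω, Z ω)) (y, z) =
        ∑ u, k y u * pr μ Y y * pr μ (fun ω => (Z ω, W ω)) (z, u) / pr μ W u := by
      intro y z
      rw [pr_eq_sum _ hW]
      refine Finset.sum_congr rfl fun u _ => ?_
      rw [← hk, ← hYZ y z u, ← pr_rotate W Y Z]
      by_cases h0 : pr μ W u = 0
      · rw [h0, div_zero, pr_rotate W Y Z, pr_pair_eq_zero_right h0]
      · rw [mul_div_cancel_right₀ _ h0]
    intro y y' z h
    rw [hsum y, hsum y', Finset.sum_mul, Finset.mul_sum]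
    refine Finset.sum_congr rfl fun u _ => ?_
    rw [h]
    ring
  have hlaw : ∀ y z, pr μ (fun ω => (Y ω, Z ω)) (y, z) ≠ 0 →
      ∀ u, k y u = pr μ (fun ω => (W ω, Z ω)) (u, z) / pr μ Z z := by
    intro y z h u
    have hy : pr μ Y y ≠ 0 := fun h0 => h (pr_pair_eq_zero_right h0 _ _)
    have hz : pr μ Z z ≠ 0 := fun h0 => h (pr_pair_eq_zero h0 _ _)
    have h1 := hZW z u y
    have h2 := hWY u y z
    rw [pr_rotate Y Z W, pr_rotate W Y Z, pr_swap Y Z] at h1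
    rw [div_eq_div_iff hy hz]
    refine mul_left_cancel₀ h ?_
    linear_combination pr μ Y y * h2 - pr μ Z z * h1
  have hfY : Measurable fun ω => f (Y ω) := (Measurable.of_discrete (f := f)).comp hY
  refine ⟨n, f, ?_, ?_, ?_⟩
  · rw [cmi_eq_zero_iff _ hY hZ]
    intro y z t
    have htriple : ∀ y', pr μ (fun ω => (Y ω, (Z ω, f (Y ω)))) (y', (z, t)) =
        if f y' = t then pr μ (fun ω => (Y ω, Z ω)) (y', z) else 0 := fun y' => by
      rw [← pr_pair_comp_pair]
      exact pr_congr fun ω => by grind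
    rw [pr_eq_sum (fun ω => f (Y ω)) hY t, pr_eq_sum (fun ω => (Z ω, f (Y ω))) hY (z, t)]
    simp only [pr_pair_comp, htriple]
    split_ifs with ht
    · subst ht
      rw [Finset.mul_sum, Finset.mul_sum]
      refine Finset.sum_congr rfl fun y' _ => ?_
      split_ifs with h
      · exact hcross y y' z ((hf y' y).1 h)
      · rw [mul_zero, mul_zero]
    · rw [zero_mul, zero_mul]
  · rw [condEnt_eq_zero_iff _ hfY]
    intro x x' y hne
    simp only [pr_swap Y, pr_pair_comp]
    grind
  · rw [condEnt_eq_zero_iff _ hfY]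
    intro x x' z hne
    by_contra! h
    have hex : ∀ x, pr μ (fun ω => (f (Y ω), Z ω)) (x, z) ≠ 0 →
        ∃ y, f y = x ∧ pr μ (fun ω => (Y ω, Z ω)) (y, z) ≠ 0 := by
      intro x hx
      rw [pr_eq_sum _ hY] at hx
      obtain ⟨y, -, hy⟩ := Finset.exists_ne_zero_of_sum_ne_zero hx
      rw [pr_pair_comp_pair, ite_ne_right_iff] at hy
      exact ⟨y, hy⟩
    obtain ⟨y, rfl, hy⟩ := hex x h.1
    obtain ⟨y', rfl, hy'⟩ := hex x' h.2
    exact hne ((hf y y').2 (funext fun u => (hlaw y z hy u).trans (hlaw y' z hy' u).symm))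

end Pr

/-- an adjoinable common part X with I(Y;Z|X) = H(X|Y) = H(X|Z) = 0 exists
iff an adjoinable U with I(Y;Z|U) = I(Z;U|Y) = I(U;Y|Z) = 0 exists. -/
theorem stmt_16 {Ω : Type*} [MeasurableSpace Ω] (μ : Measure Ω) [IsProbabilityMeasure μ]
    {SY SZ : Type*} [Fintype SY] [Fintype SZ]
    [MeasurableSpace SY] [MeasurableSingletonClass SY]
    [MeasurableSpace SZ] [MeasurableSingletonClass SZ]
    (Y : Ω → SY) (Z : Ω → SZ) (hY : Measurable Y) (hZ : Measurable Z) :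
    (∃ (P : ProbSpace) (Y' : P.carrier → SY) (Z' : P.carrier → SZ)
      (TX : FinAlphabet) (X : P.carrier → TX.carrier),
      Measurable Y' ∧ Measurable Z' ∧ Measurable X ∧
      IdentDistrib (fun ω => (Y ω, Z ω)) (fun ω => (Y' ω, Z' ω)) μ P.μ ∧
      cmi P.μ Y' Z' X = 0 ∧ condEnt P.μ X Y' = 0 ∧ condEnt P.μ X Z' = 0) ↔
    (∃ (P : ProbSpace) (Y' : P.carrier → SY) (Z' : P.carrier → SZ)
      (TU : FinAlphabet) (U : P.carrier → TU.carrier),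
      Measurable Y' ∧ Measurable Z' ∧ Measurable U ∧
      IdentDistrib (fun ω => (Y ω, Z ω)) (fun ω => (Y' ω, Z' ω)) μ P.μ ∧
      cmi P.μ Y' Z' U = 0 ∧ cmi P.μ Z' U Y' = 0 ∧ cmi P.μ U Y' Z' = 0) := by
  constructor
  · rintro ⟨P, Y', Z', TX, X, hY', hZ', hX, hid, h, hXY, hXZ⟩
    exact ⟨P, Y', Z', TX, X, hY', hZ', hX, hid, h,
      cmi_swap_eq_zero hX hZ' (cmi_eq_zero_of_condEnt_eq_zero hX hZ' hXY),
      cmi_eq_zero_of_condEnt_eq_zero hX hY' hXZ⟩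
  · rintro ⟨P, Y', Z', TU, U, hY', hZ', hU, hid, h, hZU, hUY⟩
    obtain ⟨n, f, hf, hfY, hfZ⟩ := exists_common_part hY' hZ' hU h hZU hUY
    exact ⟨P, Y', Z', ⟨Fin n⟩, fun ω => f (Y' ω), hY', hZ',
      (Measurable.of_discrete (f := f)).comp hY', hid, hf, hfY, hfZ⟩

end CIPaper
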